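/- Let p > 2 and set t*(p) = ((8 + p(2p−7))/((p−1)(3p−4)))^(1/(p−2)). Then t*(p) ∈ (0,1), and g(t) < 0 for every t ∈ (t*(p), ∞) with t ≠ 1. -/

import Mathlib

/-- `f(t) = t²/2 - tᵖ/p`. -/
noncomputable def f (p t : ℝ) : ℝ := t ^ 2 / 2 - t ^ p / p

/-- First derivative: `f'(t) = t - t^(p-1)`. -/
noncomputable def f' (p t : ℝ) : ℝ := t - t ^ (p - 1)

/-- Second derivative: `f''(t) = 1 - (p-1) t^(p-2)`. -/
noncomputable def f'' (p t : ℝ) : ℝ := 1 - (p - 1) * t ^ (p - 2)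

/-- Third derivative: `f'''(t) = -(p-1)(p-2) t^(p-3)`. -/
noncomputable def f''' (p t : ℝ) : ℝ := -(p - 1) * (p - 2) * t ^ (p - 3)

/-- `g(t) = -3 f''(t) f'(t)² + 6 (f(t)-f(1)) f''(t)² - 2 (f(t)-f(1)) f'''(t) f'(t)`. -/
noncomputable def g (p t : ℝ) : ℝ :=
  -3 * f'' p t * (f' p t) ^ 2 + 6 * (f p t - f p 1) * (f'' p t) ^ 2
    - 2 * (f p t - f p 1) * f''' p t * f' p t

theorem lt_of_hasDerivAt_sign {h h' : ℝ → ℝ} {a t : ℝ} (hta : t ≠ a)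
    (hd : ∀ x ∈ Set.uIcc t a, HasDerivAt h (h' x) x)
    (hpos : ∀ x ∈ Set.uIcc t a, x < a → 0 < h' x)
    (hneg : ∀ x ∈ Set.uIcc t a, a < x → h' x < 0) : h t < h a := by
  have hc : ContinuousOn h (Set.uIcc t a) := fun x hx =>
    (hd x hx).continuousAt.continuousWithinAt
  rcases lt_or_gt_of_ne hta with hlt | hlt
  · rw [Set.uIcc_of_le hlt.le] at hd hpos hc
    refine strictMonoOn_of_deriv_pos (convex_Icc t a) hc (fun x hx => ?_)
      (Set.left_mem_Icc.2 hlt.le) (Set.right_mem_Icc.2 hlt.le) hlt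
    rw [interior_Icc] at hx
    rw [(hd x (Set.Ioo_subset_Icc_self hx)).deriv]
    exact hpos x (Set.Ioo_subset_Icc_self hx) hx.2
  · rw [Set.uIcc_of_ge hlt.le] at hd hneg hc
    refine strictAntiOn_of_deriv_neg (convex_Icc a t) hc (fun x hx => ?_)
      (Set.left_mem_Icc.2 hlt.le) (Set.right_mem_Icc.2 hlt.le) hlt
    rw [interior_Icc] at hx
    rw [(hd x (Set.Ioo_subset_Icc_self hx)).deriv]
    exact hneg x (Set.Ioo_subset_Icc_self hx) hx.1

theorem hasDerivAt_f {p x : ℝ} (hp : 2 < p) (hx : 0 < x) : HasDerivAt (f p) (f' p x) x := by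
  have h := ((hasDerivAt_pow 2 x).div_const 2).sub
    ((Real.hasDerivAt_rpow_const (p := p) (Or.inl hx.ne')).div_const p)
  refine h.congr_deriv ?_
  have : p ≠ 0 := by linarith
  simp only [f']
  field_simp
  norm_num
  ring

theorem hasDerivAt_f' {p x : ℝ} (hx : 0 < x) : HasDerivAt (f' p) (f'' p x) x := by
  refine ((hasDerivAt_id x).sub
    (Real.hasDerivAt_rpow_const (p := p - 1) (Or.inl hx.ne'))).congr_deriv ?_
  rw [f'', show p - 1 - 1 = p - 2 by ring]

theorem hasDerivAt_f'' {p x : ℝ} (hx : 0 < x) : HasDerivAt (f'' p) (f''' p x) x := by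
  refine ((hasDerivAt_const x (1 : ℝ)).sub
    ((Real.hasDerivAt_rpow_const (p := p - 2) (Or.inl hx.ne')).const_mul (p - 1))).congr_deriv ?_
  rw [f''', show p - 2 - 1 = p - 3 by ring]
  ring

theorem hasDerivAt_f''' {p x : ℝ} (hx : 0 < x) :
    HasDerivAt (f''' p) (-(p - 1) * (p - 2) * ((p - 3) * x ^ (p - 4))) x := by
  refine ((Real.hasDerivAt_rpow_const (p := p - 3) (Or.inl hx.ne')).const_mul
    (-(p - 1) * (p - 2))).congr_deriv ?_
  rw [show p - 3 - 1 = p - 4 by ring]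

theorem f'_eq {p x : ℝ} (hx : 0 < x) : f' p x = x * (1 - x ^ (p - 2)) := by
  rw [f', show p - 1 = (p - 2) + 1 by ring, Real.rpow_add_one hx.ne']
  ring

theorem f'_pos {p x : ℝ} (hp : 2 < p) (hx : 0 < x) (hx1 : x < 1) : 0 < f' p x := by
  rw [f'_eq hx]
  exact mul_pos hx (sub_pos.2 (Real.rpow_lt_one hx.le hx1 (by linarith)))

theorem f'_neg {p x : ℝ} (hp : 2 < p) (hx1 : 1 < x) : f' p x < 0 := by
  have hx : 0 < x := by linarith
  rw [f'_eq hx]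
  exact mul_neg_of_pos_of_neg hx (sub_neg.2 (Real.one_lt_rpow hx1 (by linarith)))

theorem f_lt_f_one {p t : ℝ} (hp : 2 < p) (ht : 0 < t) (ht1 : t ≠ 1) : f p t < f p 1 := by
  have hpos : ∀ x ∈ Set.uIcc t 1, 0 < x := fun x hx => (lt_min ht one_pos).trans_le hx.1
  exact lt_of_hasDerivAt_sign ht1 (fun x hx => hasDerivAt_f hp (hpos x hx))
    (fun x hx => f'_pos hp (hpos x hx)) (fun x _ => f'_neg hp)

/-- The coefficient of `f - f 1` in `g` is positive. -/
theorem coeff_pos {p x : ℝ} (hp : 2 < p) (hx : 0 < x) :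
    0 < 6 * f'' p x ^ 2 - 2 * f''' p x * f' p x := by
  have hs : 0 < x ^ (p - 2) := Real.rpow_pos_of_pos hx _
  have h3 : x ^ (p - 2) = x ^ (p - 3) * x := by
    rw [show p - 2 = (p - 3) + 1 by ring, Real.rpow_add_one hx.ne']
  have key : 6 * f'' p x ^ 2 - 2 * f''' p x * f' p x =
      6 * (1 - (p - 1) * x ^ (p - 2)) ^ 2
        + 2 * (p - 1) * (p - 2) * x ^ (p - 2) * (1 - x ^ (p - 2)) := by
    rw [f'_eq hx, f'', f''', h3]
    ring
  rw [key]
  generalize x ^ (p - 2) = s at hs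
  obtain ⟨q, rfl⟩ : ∃ q, p = q + 2 := ⟨p - 2, by ring⟩
  have hq : 0 < q := by linarith
  rcases le_or_gt 1 s with h | h
  · obtain ⟨u, rfl⟩ : ∃ u, s = 1 + u := ⟨s - 1, by ring⟩
    have hu : 0 ≤ u := by linarith
    ring_nf
    positivity
  · have h1 : 0 < 1 - s := by linarith
    have h2 : 0 < q + 2 - 1 := by linarith
    have h3 : 0 < q + 2 - 2 := by linarith
    positivity

/-- The discriminant `5 f'''² - 3 f'' f''''` is positive wherever `f''` is negative. -/
theorem discr_pos {p x : ℝ} (hp : 2 < p) (hx : 0 < x) (hf : f'' p x < 0) :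
    0 < 5 * f''' p x ^ 2
      - 3 * f'' p x * (-(p - 1) * (p - 2) * ((p - 3) * x ^ (p - 4))) := by
  have h4 : 0 < x ^ (p - 4) := Real.rpow_pos_of_pos hx _
  have h3 : x ^ (p - 3) = x ^ (p - 4) * x := by
    rw [show p - 3 = (p - 4) + 1 by ring, Real.rpow_add_one hx.ne']
  have h2 : x ^ (p - 2) = x ^ (p - 4) * x * x := by
    rw [show p - 2 = (p - 3) + 1 by ring, Real.rpow_add_one hx.ne', h3]
  have key : 5 * f''' p x ^ 2 - 3 * f'' p x * (-(p - 1) * (p - 2) * ((p - 3) * x ^ (p - 4))) =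
      (p - 1) * (p - 2) * x ^ (p - 4) *
        ((2 * p - 1) * ((p - 1) * (x ^ (p - 4) * x * x)) + 3 * (p - 3)) := by
    rw [f'', f''', h2, h3]
    ring
  rw [key]
  rw [f'', h2] at hf
  have hp1 : 0 < p - 1 := by linarith
  have hp2 : 0 < p - 2 := by linarith
  refine mul_pos (by positivity) ?_
  nlinarith

theorem f_sub_lt {p t : ℝ} (hp : 2 < p) (ht : 0 < t) (ht1 : t ≠ 1) (hf : f'' p t < 0) :
    f p t - f p 1 <
      3 * (f'' p t * f' p t ^ 2) / (6 * f'' p t ^ 2 - 2 * f''' p t * f' p t) := by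
  have hpos : ∀ x ∈ Set.uIcc t 1, 0 < x := fun x hx => (lt_min ht one_pos).trans_le hx.1
  have hf'' : ∀ x ∈ Set.uIcc t 1, f'' p x < 0 := by
    have hp1 : 0 < p - 1 := by linarith
    intro x hx
    rw [f''] at hf ⊢
    rcases min_le_iff.1 hx.1 with h | h
    · have := Real.rpow_le_rpow ht.le h (show 0 ≤ p - 2 by linarith)
      nlinarith
    · have := Real.one_le_rpow h (show 0 ≤ p - 2 by linarith)
      nlinarith
  have hdiscr := fun x hx => discr_pos hp (hpos x hx) (hf'' x hx)
  have hcoeff := fun x hx => coeff_pos hp (hpos x hx)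
  have hd : ∀ x ∈ Set.uIcc t 1, HasDerivAt
      (fun x => f p x - 3 * (f'' p x * f' p x ^ 2) / (6 * f'' p x ^ 2 - 2 * f''' p x * f' p x))
      (2 * f' p x ^ 3 * (5 * f''' p x ^ 2
        - 3 * f'' p x * (-(p - 1) * (p - 2) * ((p - 3) * x ^ (p - 4))))
          / (6 * f'' p x ^ 2 - 2 * f''' p x * f' p x) ^ 2) x := by
    intro x hx
    have hx0 := hpos x hx
    have hK := (hcoeff x hx).ne'
    have h1 := hasDerivAt_f' (p := p) hx0
    have h2 := hasDerivAt_f'' (p := p) hx0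
    have h3 := hasDerivAt_f''' (p := p) hx0
    have hN := (h2.mul (h1.pow 2)).const_mul 3
    have hD := ((h2.pow 2).const_mul 6).sub ((h3.const_mul 2).mul h1)
    refine ((hasDerivAt_f hp hx0).sub (hN.div hD hK)).congr_deriv ?_
    simp only [Pi.mul_apply, Pi.pow_apply, Pi.sub_apply]
    generalize -(p - 1) * (p - 2) * ((p - 3) * x ^ (p - 4)) = d
    generalize f' p x = a at *
    generalize f'' p x = b at *
    generalize f''' p x = c at *
    rw [eq_div_iff (pow_ne_zero 2 hK), sub_mul, div_mul_cancel₀ _ (pow_ne_zero 2 hK)]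
    push_cast
    ring
  have h := lt_of_hasDerivAt_sign ht1 hd
    (fun x hx hx1 => div_pos (mul_pos (mul_pos two_pos (pow_pos (f'_pos hp (hpos x hx) hx1) 3))
      (hdiscr x hx)) (pow_pos (hcoeff x hx) 2))
    (fun x hx hx1 => div_neg_of_neg_of_pos (mul_neg_of_neg_of_pos
      (mul_neg_of_pos_of_neg two_pos (Odd.pow_neg (by decide) (f'_neg hp hx1)))
      (hdiscr x hx)) (pow_pos (hcoeff x hx) 2))
  have h1 : f' p 1 = 0 := by simp [f']
  simp only [h1] at h
  norm_num at h
  linarith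

theorem g_neg {p t : ℝ} (hp : 2 < p) (ht : 0 < t) (ht1 : t ≠ 1) : g p t < 0 := by
  have hK := coeff_pos hp ht
  have hg : g p t = (f p t - f p 1) * (6 * f'' p t ^ 2 - 2 * f''' p t * f' p t)
      - 3 * (f'' p t * f' p t ^ 2) := by
    rw [g]
    ring
  rw [hg, sub_neg]
  rcases lt_or_ge (f'' p t) 0 with hf | hf
  · exact (lt_div_iff₀ hK).1 (f_sub_lt hp ht ht1 hf)
  · have hF := sub_neg.2 (f_lt_f_one hp ht ht1)
    exact (mul_neg_of_neg_of_pos hF hK).trans_le (by positivity)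

/-- let `p > 2` and `t*(p) = ((8+p(2p-7))/((p-1)(3p-4)))^(1/(p-2))`.
Then `t*(p) ∈ (0,1)` and `g(t) < 0` for every `t ∈ (t*(p), ∞)` with `t ≠ 1`. -/
theorem stmt_11 (p : ℝ) (hp : 2 < p) :
    ((8 + p * (2 * p - 7)) / ((p - 1) * (3 * p - 4))) ^ (1 / (p - 2)) ∈ Set.Ioo (0 : ℝ) 1 ∧
    ∀ t : ℝ, ((8 + p * (2 * p - 7)) / ((p - 1) * (3 * p - 4))) ^ (1 / (p - 2)) < t →
      t ≠ 1 → g p t < 0 := by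
  have hnum : 0 < 8 + p * (2 * p - 7) := by nlinarith [sq_nonneg (4 * p - 7)]
  have hden : 0 < (p - 1) * (3 * p - 4) := mul_pos (by linarith) (by linarith)
  have hpos := Real.rpow_pos_of_pos (div_pos hnum hden) (1 / (p - 2))
  refine ⟨⟨hpos, Real.rpow_lt_one (div_pos hnum hden).le ?_ ?_⟩,
    fun t ht ht1 => g_neg hp (hpos.trans ht) ht1⟩
  · rw [div_lt_one hden]
    nlinarith
  · exact one_div_pos.2 (by linarith)
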